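/- Reiman-type bound for t = n − 2: let q ≥ 1 and n > q. Let C be a finite set of multisets over Fin q, each of cardinality n, such that every two distinct S, T ∈ C satisfy card(S ∩ T) ≤ 1 (i.e., C corrects n − 2 deletions). Then |C| · (n − q) ≤ q · (n − 1); equivalently |C| ≤ q(n−1)/(n−q). -/

import Mathlib

theorem Multiset.exists_two_le_count_of_lt_card {α : Type*} [Fintype α] [DecidableEq α]
    {S : Multiset α} (h : Fintype.card α < Multiset.card S) : ∃ x, 2 ≤ S.count x := by
  by_contra! hS
  have hnd : S.Nodup := Multiset.nodup_iff_count_le_one.2 fun x => Nat.le_of_lt_succ (hS x)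
  exact absurd (Finset.card_le_univ (⟨S, hnd⟩ : Finset α)) (not_le.2 h)

/-- Reiman-type bound for `t = n - 2`: if `n > q` and every two distinct
codewords intersect in at most one element, then `|C| (n - q) ≤ q (n - 1)`. -/
theorem multiset_reiman_bound_t_eq_n_sub_two (q n : ℕ) (hq : 1 ≤ q) (hn : q < n)
    (C : Finset (Multiset (Fin q)))
    (hcard : ∀ S ∈ C, Multiset.card S = n)
    (hint : ∀ S ∈ C, ∀ T ∈ C, S ≠ T → Multiset.card (S ∩ T) ≤ 1) :
    C.card * (n - q) ≤ q * (n - 1) := by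
  have hrep : ∀ S ∈ C, ∃ x, 2 ≤ S.count x := fun S hS =>
    Multiset.exists_two_le_count_of_lt_card (by simpa [hcard S hS] using hn)
  have : Nonempty (Fin q) := ⟨⟨0, hq⟩⟩
  choose! f hf using hrep
  have hinj : Set.InjOn f C := by
    intro S hS T hT hST
    by_contra hne
    have hcount : 2 ≤ (S ∩ T).count (f S) := by
      rw [Multiset.count_inter]
      exact le_min (hf S hS) (hST ▸ hf T hT)
    have := Multiset.count_le_card (f S) (S ∩ T)
    have := hint S hS T hT hne
    omega
  have hC : C.card ≤ q := by
    simpa using Finset.card_le_card_of_injOn f (fun _ _ => Finset.mem_univ _) hinj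
  exact Nat.mul_le_mul hC (Nat.sub_le_sub_left hq n)
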